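/- Let n be an odd positive integer. There do not exist real multivariate polynomials g₁,…,g_n, g₀ and h₁,…,h_t in the variables x₁,…,x_n such that ∑_{i=1}^n g_i·(x_i² − 1) + g₀·(∑_{i=1}^n x_i) = ∑_{j=1}^t h_j² + 1 identically, with totalDegree(g_i·(x_i² − 1)) ≤ n − 1 for all i, totalDegree(g₀·∑_i x_i) ≤ n − 1, and totalDegree(h_j²) ≤ n − 1 for all j. In other words, every sum-of-squares refutation of the system {x_i² = 1 for all i; ∑_i x_i = 0} has degree at least n + 1. -/

import Mathlib

open Finset Equiv

section LowDegree

variable {σ R : Type*} [CommRing R] [Algebra ℝ R]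

/-- The span of the multilinear monomials of degree at most `d` in the elements `x i`, `i ∈ A`. -/
def lowDegree (x : σ → R) (A : Finset σ) (d : ℕ) : Submodule ℝ R :=
  Submodule.span ℝ ((fun S : Finset σ => ∏ i ∈ S, x i) '' {S | S ⊆ A ∧ #S ≤ d})

variable {x : σ → R} {A B : Finset σ} {d e : ℕ}

theorem prod_mem_lowDegree {S : Finset σ} (hS : S ⊆ A) (hd : #S ≤ d) :
    ∏ i ∈ S, x i ∈ lowDegree x A d :=
  Submodule.subset_span ⟨S, ⟨hS, hd⟩, rfl⟩

theorem lowDegree_induction {p : R → Prop}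
    (prod : ∀ S ⊆ A, #S ≤ d → p (∏ i ∈ S, x i)) (zero : p 0)
    (add : ∀ f g, p f → p g → p (f + g)) (smul : ∀ (c : ℝ) f, p f → p (c • f))
    {f : R} (hf : f ∈ lowDegree x A d) : p f := by
  refine Submodule.span_induction ?_ zero (fun f g _ _ => add f g) (fun c f _ => smul c f) hf
  rintro _ ⟨S, ⟨hS, hd⟩, rfl⟩
  exact prod S hS hd

theorem lowDegree_mono (hAB : A ⊆ B) (hde : d ≤ e) : lowDegree x A d ≤ lowDegree x B e :=
  Submodule.span_mono <| Set.image_mono fun _ h => ⟨h.1.trans hAB, h.2.trans hde⟩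

theorem one_mem_lowDegree : (1 : R) ∈ lowDegree x A d := by
  simpa using prod_mem_lowDegree (x := x) (A := A) (d := d) (S := ∅) (by simp) (by simp)

theorem mul_prod_of_mem {M : Type*} [CommMonoid M] {x : σ → M} [DecidableEq σ]
    (hx : ∀ i, x i ^ 2 = 1) {S : Finset σ} {i : σ} (hi : i ∈ S) :
    x i * ∏ j ∈ S, x j = ∏ j ∈ S.erase i, x j := by
  rw [← mul_prod_erase S x hi, ← mul_assoc, ← sq, hx, one_mul]

theorem generator_mul_mem_lowDegree [DecidableEq σ] (hx : ∀ i, x i ^ 2 = 1) {i : σ} (hi : i ∈ A) {f : R}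
    (hf : f ∈ lowDegree x A d) : x i * f ∈ lowDegree x A (d + 1) := by
  refine lowDegree_induction (p := fun f => x i * f ∈ lowDegree x A (d + 1)) ?_ (by simp)
    (fun f g hf hg => by rw [mul_add]; exact add_mem hf hg)
    (fun c f hf => by rw [mul_smul_comm]; exact Submodule.smul_mem _ c hf) hf
  intro S hS hd
  by_cases h : i ∈ S
  · rw [mul_prod_of_mem hx h]
    exact prod_mem_lowDegree ((erase_subset _ _).trans hS) (by grind)
  · rw [← prod_insert h]
    exact prod_mem_lowDegree (insert_subset hi hS) (by grind)

theorem mul_mem_lowDegree [DecidableEq σ] (hx : ∀ i, x i ^ 2 = 1) {f g : R}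
    (hf : f ∈ lowDegree x A d) (hg : g ∈ lowDegree x A e) : f * g ∈ lowDegree x A (d + e) := by
  refine lowDegree_induction (p := fun f => f * g ∈ lowDegree x A (d + e)) ?_ (by simp)
    (fun f f' hf hf' => by rw [add_mul]; exact add_mem hf hf')
    (fun c f hf => by rw [smul_mul_assoc]; exact Submodule.smul_mem _ c hf) hf
  intro S hS hd
  suffices h : (∏ i ∈ S, x i) * g ∈ lowDegree x A (#S + e) from
    lowDegree_mono Subset.rfl (by omega) h
  clear hd
  induction S using Finset.induction_on with
  | empty => simpa using hg
  | insert a S ha ih =>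
    rw [prod_insert ha, mul_assoc, card_insert_of_notMem ha, add_right_comm]
    exact generator_mul_mem_lowDegree hx (hS (mem_insert_self _ _))
      (ih ((subset_insert _ _).trans hS))

theorem generator_mem_lowDegree [DecidableEq σ] (hx : ∀ i, x i ^ 2 = 1) {i : σ} (hi : i ∈ A) :
    x i ∈ lowDegree x A 1 := by
  simpa using generator_mul_mem_lowDegree hx hi (one_mem_lowDegree (d := 0))

theorem lowDegree_zero_exists {f : R} (hf : f ∈ lowDegree x A 0) : ∃ c : ℝ, f = c • 1 := by
  refine lowDegree_induction (p := fun f : R => ∃ c : ℝ, f = c • 1) ?_ ⟨0, by simp⟩ ?_ ?_ hf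
  · intro S _ hS
    exact ⟨1, by simp [card_eq_zero.1 (Nat.le_zero.1 hS)]⟩
  · rintro _ _ ⟨a, rfl⟩ ⟨b, rfl⟩
    exact ⟨a + b, by rw [add_smul]⟩
  · rintro c _ ⟨a, rfl⟩
    exact ⟨c * a, by rw [mul_smul]⟩

end LowDegree

section Balanced

variable {σ R : Type*} [CommRing R] [Algebra ℝ R]

/-- The permutation `π` moves only elements of `A`. -/
def FixesOutside (A : Finset σ) (π : Perm σ) : Prop := ∀ i ∉ A, π i = i

/-- `L` behaves on polynomials in the signs `x i`, `i ∈ A`, of degree less than `#A` like an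
exchangeable expectation for which `∑ i ∈ A, x i` vanishes. -/
structure IsBalanced (x : σ → R) (act : Perm σ →* (R →ₐ[ℝ] R)) (A : Finset σ)
    (L : R →ₗ[ℝ] ℝ) : Prop where
  map_act : ∀ π, FixesOutside A π → ∀ f, L (act π f) = L f
  map_mul_sum : ∀ d, d + 2 ≤ #A → ∀ f ∈ lowDegree x A d, L (f * ∑ i ∈ A, x i) = 0
  map_one_nonneg : 0 ≤ L 1

theorem FixesOutside.swap [DecidableEq σ] {A : Finset σ} {i j : σ} (hi : i ∈ A) (hj : j ∈ A) :
    FixesOutside A (swap i j) := fun _ hk =>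
  swap_apply_of_ne_of_ne (fun h => hk (h ▸ hi)) (fun h => hk (h ▸ hj))

theorem FixesOutside.mul {A : Finset σ} {π ρ : Perm σ} (hπ : FixesOutside A π)
    (hρ : FixesOutside A ρ) : FixesOutside A (π * ρ) := fun k hk => by
  rw [Perm.mul_apply, hρ k hk, hπ k hk]

theorem FixesOutside.inv {A : Finset σ} {π : Perm σ} (hπ : FixesOutside A π) :
    FixesOutside A π⁻¹ := fun k hk => by
  rw [Perm.inv_eq_iff_eq, hπ k hk]

theorem FixesOutside.mono {A B : Finset σ} (hAB : A ⊆ B) {π : Perm σ} (hπ : FixesOutside A π) :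
    FixesOutside B π := fun k hk => hπ k fun h => hk (hAB h)

theorem FixesOutside.apply_mem_iff {A : Finset σ} {π : Perm σ} (hπ : FixesOutside A π) {i : σ} :
    π i ∈ A ↔ i ∈ A := by
  refine ⟨fun h => ?_, fun hi => ?_⟩
  · by_contra hi
    exact hi (hπ i hi ▸ h)
  · by_contra h
    have h1 : π (π i) = π i := hπ _ h
    rw [EmbeddingLike.apply_eq_iff_eq] at h1
    exact h (h1.symm ▸ hi)

theorem FixesOutside.map_subset {A S : Finset σ} {π : Perm σ} (hπ : FixesOutside A π)
    (hS : S ⊆ A) : S.map π.toEmbedding ⊆ A := by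
  intro j hj
  obtain ⟨i, hi, rfl⟩ := mem_map.1 hj
  exact hπ.apply_mem_iff.2 (hS hi)

variable {x : σ → R} {act : Perm σ →* (R →ₐ[ℝ] R)} {A B : Finset σ} {d m : ℕ}

theorem act_prod (hact : ∀ π i, act π (x i) = x (π i)) (π : Perm σ) (S : Finset σ) :
    act π (∏ i ∈ S, x i) = ∏ i ∈ S.map π.toEmbedding, x i := by
  simp [map_prod, hact]

theorem act_mem_lowDegree (hact : ∀ π i, act π (x i) = x (π i)) {π : Perm σ}
    (hπ : FixesOutside A π) {f : R} (hf : f ∈ lowDegree x A d) :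
    act π f ∈ lowDegree x A d := by
  refine lowDegree_induction (p := fun f => act π f ∈ lowDegree x A d) ?_ (by simp)
    (fun f g hf hg => by rw [map_add]; exact add_mem hf hg)
    (fun c f hf => by rw [map_smul]; exact Submodule.smul_mem _ c hf) hf
  intro S hS hd
  rw [act_prod hact]
  exact prod_mem_lowDegree (hπ.map_subset hS) (by simpa using hd)

theorem exists_sub_swap_eq [DecidableEq σ] (hact : ∀ π i, act π (x i) = x (π i)) {i j : σ}
    (hij : i ≠ j) {f : R} (hf : f ∈ lowDegree x A (d + 1)) :
    ∃ q ∈ lowDegree x ((A.erase i).erase j) d, f - act (swap i j) f = (x i - x j) * q := by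
  refine lowDegree_induction (p := fun f => ∃ q ∈ lowDegree x ((A.erase i).erase j) d,
    f - act (swap i j) f = (x i - x j) * q) ?_ ⟨0, zero_mem _, by simp⟩ ?_ ?_ hf
  · intro S hS hd
    have fix : ∀ T : Finset σ, i ∉ T → j ∉ T →
        act (swap i j) (∏ k ∈ T, x k) = ∏ k ∈ T, x k := by
      intro T hi hj
      rw [map_prod]
      refine prod_congr rfl fun k hk => ?_
      rw [hact, swap_apply_of_ne_of_ne] <;> grind
    by_cases hi : i ∈ S <;> by_cases hj : j ∈ S
    · refine ⟨0, zero_mem _, ?_⟩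
      have hj' : j ∈ S.erase i := by grind
      rw [← mul_prod_erase S x hi, ← mul_prod_erase _ x hj', map_mul, map_mul,
        fix _ (by grind) (by grind), hact, hact, swap_apply_left, swap_apply_right]
      ring
    · refine ⟨∏ k ∈ S.erase i, x k, prod_mem_lowDegree (by grind) (by grind), ?_⟩
      rw [← mul_prod_erase S x hi, map_mul, fix _ (by grind) (by grind), hact, swap_apply_left]
      ring
    · refine ⟨-∏ k ∈ S.erase j, x k, neg_mem (prod_mem_lowDegree (by grind) (by grind)), ?_⟩
      rw [← mul_prod_erase S x hj, map_mul, fix _ (by grind) (by grind), hact, swap_apply_right]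
      ring
    · exact ⟨0, zero_mem _, by rw [fix _ hi hj]; ring⟩
  · rintro f g ⟨p, hp, hfp⟩ ⟨q, hq, hgq⟩
    refine ⟨p + q, add_mem hp hq, ?_⟩
    rw [map_add, mul_add, ← hfp, ← hgq]
    ring
  · rintro c f ⟨p, hp, hfp⟩
    refine ⟨c • p, Submodule.smul_mem _ _ hp, ?_⟩
    rw [map_smul, ← smul_sub, hfp, mul_smul_comm]

theorem IsBalanced.mul_sq_sub [DecidableEq σ] (hx : ∀ i, x i ^ 2 = 1)
    (hact : ∀ π i, act π (x i) = x (π i))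
    {L : R →ₗ[ℝ] ℝ} (hL : IsBalanced x act A L) (hA : 3 ≤ #A) {i j : σ} (hi : i ∈ A)
    (hj : j ∈ A) (hij : i ≠ j) :
    IsBalanced x act ((A.erase i).erase j) (L ∘ₗ LinearMap.mulLeft ℝ ((x i - x j) ^ 2)) where
  map_act π hπ f := by
    have h := hL.map_act π (hπ.mono (by grind)) ((x i - x j) ^ 2 * f)
    rw [map_mul, map_pow, map_sub, hact, hact, hπ i (by simp), hπ j (by simp)] at h
    simpa using h
  map_mul_sum d hd f hf := by
    have hmem : (x i - x j) ^ 2 * f ∈ lowDegree x A (1 + 1 + d) := by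
      have h1 : x i - x j ∈ lowDegree x A 1 :=
        sub_mem (generator_mem_lowDegree hx hi) (generator_mem_lowDegree hx hj)
      rw [sq]
      exact mul_mem_lowDegree hx (mul_mem_lowDegree hx h1 h1)
        (lowDegree_mono (by grind) le_rfl hf)
    have hj' : j ∈ A.erase i := by grind
    have h := hL.map_mul_sum (1 + 1 + d) (by grind) _ hmem
    rw [← add_sum_erase A x hi, ← add_sum_erase _ x hj'] at h
    rw [LinearMap.comp_apply, LinearMap.mulLeft_apply, ← h]
    refine congrArg L ?_
    linear_combination (-(f * (x i - x j))) * (hx i - hx j)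
  map_one_nonneg := by
    have h := hL.map_mul_sum 1 hA _ (generator_mem_lowDegree hx hi)
    have hc : ∀ k ∈ A.erase i, L (x i * x k) = L (x i * x j) := by
      intro k hk
      rw [← hL.map_act (swap k j) (FixesOutside.swap (by grind) hj), map_mul, hact, hact,
        swap_apply_left, swap_apply_of_ne_of_ne (by grind) hij]
    rw [← add_sum_erase A x hi, mul_add, ← sq, hx, mul_sum, map_add, map_sum, sum_congr rfl hc,
      sum_const, card_erase_of_mem hi, nsmul_eq_mul, Nat.cast_sub (by omega), Nat.cast_one] at h
    have h2 : (x i - x j) ^ 2 * 1 = (1 - x i * x j) + (1 - x i * x j) := by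
      linear_combination hx i + hx j
    rw [LinearMap.comp_apply, LinearMap.mulLeft_apply, h2, map_add, map_sub]
    have h3 : (3 : ℝ) ≤ #A := by exact_mod_cast hA
    have h1 := hL.map_one_nonneg
    by_contra! hneg
    nlinarith

theorem IsBalanced.exists_invariant_of_sub_swap_nonneg [DecidableEq σ]
    (hact : ∀ π i, act π (x i) = x (π i)) {L : R →ₗ[ℝ] ℝ} (hL : IsBalanced x act A L)
    (hsub : ∀ i ∈ A, ∀ j ∈ A, i ≠ j → ∀ f ∈ lowDegree x A d,
      0 ≤ L ((f - act (swap i j) f) ^ 2))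
    {f : R} (hf : f ∈ lowDegree x A d) (hB : B ⊆ A) :
    ∃ g ∈ lowDegree x A d, (∀ π, FixesOutside B π → act π g = g) ∧ L (g ^ 2) ≤ L (f ^ 2) := by
  induction B using Finset.induction_on with
  | empty =>
    refine ⟨f, hf, fun π hπ => ?_, le_rfl⟩
    have h1 : π = 1 := Equiv.ext fun i => hπ i (notMem_empty i)
    rw [h1, map_one, AlgHom.one_apply]
  | insert a B ha ih =>
    obtain ⟨g, hg, hinv, hle⟩ := ih ((subset_insert _ _).trans hB)
    set C := insert a B with hC
    have haC : a ∈ C := mem_insert_self _ _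
    set u : σ → R := fun b => act (swap b a) g with hu
    have act_u : ∀ π, FixesOutside C π → ∀ b ∈ C, act π (u b) = u (π b) := by
      intro π hπ b hb
      have hπb : π b ∈ C := hπ.apply_mem_iff.2 hb
      have h1 := hinv (swap (π b) a * π * swap b a) fun k hk => by
        simp only [Perm.mul_apply]
        by_cases hka : k = a
        · simp [hka]
        · have hkC : k ∉ C := by grind
          rw [swap_apply_of_ne_of_ne (by grind) hka, hπ k hkC,
            swap_apply_of_ne_of_ne (by grind) hka]
      simp only [hu]
      conv_rhs => rw [← h1]
      simp only [← AlgHom.mul_apply, ← map_mul, ← mul_assoc, swap_mul_self, one_mul]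
    have hpair : ∀ b ∈ C, ∀ c ∈ C, 0 ≤ L ((u b - u c) ^ 2) := by
      intro b hb c hc
      by_cases hbc : b = c
      · simp [hbc]
      · have h1 := act_u (swap b c) (FixesOutside.swap hb hc) b hb
        rw [swap_apply_left] at h1
        rw [← h1]
        exact hsub b (hB hb) c (hB hc) hbc _
          (act_mem_lowDegree hact (FixesOutside.swap (hB hb) (hB haC)) hg)
    have hsq : ∀ b ∈ C, L (u b ^ 2) = L (g ^ 2) := by
      intro b hb
      rw [hu, ← map_pow, hL.map_act _ (FixesOutside.swap (hB hb) (hB haC))]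
    have hN : (0 : ℝ) < #C := by exact_mod_cast card_pos.2 ⟨a, haC⟩
    refine ⟨(#C : ℝ)⁻¹ • ∑ b ∈ C, u b, Submodule.smul_mem _ _ (Submodule.sum_mem _ fun b hb =>
      act_mem_lowDegree hact (FixesOutside.swap (hB hb) (hB haC)) hg), ?_, le_trans ?_ hle⟩
    · intro π hπ
      rw [map_smul, map_sum, sum_congr rfl (act_u π hπ)]
      congr 1
      exact sum_equiv π (fun _ => hπ.apply_mem_iff.symm) fun _ _ => rfl
    · have hexp : ∑ b ∈ C, ∑ c ∈ C, (u b - u c) ^ 2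
          = (2 * #C : ℝ) • ∑ b ∈ C, u b ^ 2 - (2 : ℝ) • (∑ b ∈ C, u b) ^ 2 := by
        have h2 : ∀ b c, (u b - u c) ^ 2 = u b ^ 2 + u c ^ 2 - (2 : ℝ) • (u b * u c) := by
          intro b c
          rw [two_smul]
          ring
        simp only [h2, sum_sub_distrib, sum_add_distrib, sum_const, ← smul_sum, sq (∑ b ∈ C, u b),
          sum_mul_sum, ← Nat.cast_smul_eq_nsmul ℝ]
        module
      have h3 := sum_nonneg fun b hb => sum_nonneg (hpair b hb)
      simp only [← map_sum] at h3
      rw [hexp, map_sub, map_smul, map_smul, map_sum, sum_congr rfl hsq, sum_const, nsmul_eq_mul,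
        smul_eq_mul, smul_eq_mul] at h3
      rw [smul_pow, map_smul, smul_eq_mul, inv_pow, inv_mul_le_iff₀ (by positivity)]
      nlinarith

open Classical in
/-- The sum of the translates of `f` under the permutations moving only elements of `A`. -/
noncomputable def symmetrize [Fintype σ] (act : Perm σ →* (R →ₐ[ℝ] R)) (A : Finset σ) :
    R →ₗ[ℝ] R :=
  ∑ π with FixesOutside A π, (act π).toLinearMap

theorem symmetrize_apply_of_invariant [Fintype σ] :
    ∃ N : ℝ, 0 < N ∧ ∀ f, (∀ π, FixesOutside A π → act π f = f) → symmetrize act A f = N • f := by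
  classical
  refine ⟨#{π | FixesOutside A π}, ?_, fun f hf => ?_⟩
  · exact_mod_cast card_pos.2 ⟨1, mem_filter.2 ⟨mem_univ _, fun _ _ => rfl⟩⟩
  · rw [symmetrize, LinearMap.sum_apply, sum_congr rfl (g := fun _ => f) (by simpa using hf),
      sum_const, Nat.cast_smul_eq_nsmul]

theorem symmetrize_act [Fintype σ] {π : Perm σ} (hπ : FixesOutside A π) (f : R) :
    symmetrize act A (act π f) = symmetrize act A f := by
  classical
  simp only [symmetrize, LinearMap.sum_apply, AlgHom.toLinearMap_apply, ← AlgHom.mul_apply,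
    ← map_mul]
  refine sum_equiv (Equiv.mulRight π) (fun ρ => ?_) fun _ _ => rfl
  simp only [mem_filter, mem_univ, true_and, coe_mulRight]
  exact ⟨fun h => h.mul hπ, fun h => by simpa using h.mul hπ.inv⟩

theorem symmetrize_mul_of_invariant [Fintype σ] {g : R}
    (hg : ∀ π, FixesOutside A π → act π g = g) (f : R) :
    symmetrize act A (f * g) = symmetrize act A f * g := by
  classical
  simp only [symmetrize, LinearMap.sum_apply, AlgHom.toLinearMap_apply, sum_mul, map_mul]
  exact sum_congr rfl fun π hπ => by rw [hg π (by simpa using hπ)]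

theorem symmetrize_mem_lowDegree [Fintype σ] (hact : ∀ π i, act π (x i) = x (π i)) {f : R}
    (hf : f ∈ lowDegree x A d) : symmetrize act A f ∈ lowDegree x A d := by
  classical
  simp only [symmetrize, LinearMap.sum_apply, AlgHom.toLinearMap_apply]
  exact Submodule.sum_mem _ fun π hπ => act_mem_lowDegree hact (by simpa using hπ) hf

theorem IsBalanced.exists_map_symmetrize_prod_mul [Fintype σ] [DecidableEq σ]
    (hx : ∀ i, x i ^ 2 = 1) (hact : ∀ π i, act π (x i) = x (π i)) {L : R →ₗ[ℝ] ℝ}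
    (hL : IsBalanced x act A L) (hA : 2 * m + 1 ≤ #A) {S : Finset σ} (hS : S ⊆ A)
    (hd : #S ≤ m) :
    ∃ c : ℝ, ∀ f ∈ lowDegree x A m, L (symmetrize act A (∏ i ∈ S, x i) * f) = c * L f := by
  induction hk : #S using Nat.strong_induction_on generalizing S with
  | _ k ih =>
  rcases S.eq_empty_or_nonempty with rfl | ⟨a, ha⟩
  · obtain ⟨N, -, hN⟩ := symmetrize_apply_of_invariant (act := act) (A := A)
    refine ⟨N, fun f _ => ?_⟩
    rw [prod_empty, hN 1 (fun _ _ => map_one _), smul_mul_assoc, one_mul, map_smul, smul_eq_mul]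
  set T := S.erase a with hT
  have hST : S = insert a T := (insert_erase ha).symm
  have haT : a ∉ T := notMem_erase a S
  have hTA : T ⊆ A := (erase_subset _ _).trans hS
  have hTS : #T + 1 = #S := card_erase_add_one ha
  have hc : ∀ i ∈ T, ∃ c : ℝ, ∀ f ∈ lowDegree x A m,
      L (symmetrize act A (∏ j ∈ T.erase i, x j) * f) = c * L f := fun i hi =>
    ih _ (by grind) ((erase_subset _ _).trans hTA) (by grind) rfl
  choose! c hc using hc
  have hsum : (∏ j ∈ T, x j) * ∑ i ∈ A, x i
      = ∑ i ∈ A \ T, ∏ j ∈ insert i T, x j + ∑ i ∈ T, ∏ j ∈ T.erase i, x j := by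
    rw [← sum_sdiff hTA, mul_add, mul_sum, mul_sum]
    congr 1
    · exact sum_congr rfl fun i hi => by rw [prod_insert (by grind), mul_comm]
    · exact sum_congr rfl fun i hi => by rw [mul_comm, mul_prod_of_mem hx hi]
  have hswap : ∀ i ∈ A \ T, symmetrize act A (∏ j ∈ insert i T, x j)
      = symmetrize act A (∏ j ∈ S, x j) := by
    intro i hi
    have hiT : i ∉ T := by grind
    rw [← symmetrize_act (FixesOutside.swap (i := i) (j := a) (by grind) (hS ha)), hST,
      prod_insert hiT, prod_insert haT, map_mul, hact, swap_apply_left, map_prod]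
    congr 2
    refine prod_congr rfl fun k hk => ?_
    rw [hact, swap_apply_of_ne_of_ne] <;> grind
  have hAT : (0 : ℝ) < #(A \ T) := by
    exact_mod_cast card_pos.2 ⟨a, mem_sdiff.2 ⟨hS ha, haT⟩⟩
  refine ⟨-(∑ i ∈ T, c i) / #(A \ T), fun f hf => ?_⟩
  have hinv : ∀ π, FixesOutside A π → act π (∑ i ∈ A, x i) = ∑ i ∈ A, x i := by
    intro π hπ
    rw [map_sum]
    exact sum_equiv π (fun _ => hπ.apply_mem_iff.symm) fun _ _ => hact _ _
  have hzero := hL.map_mul_sum (#T + m) (by omega) _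
    (mul_mem_lowDegree hx (symmetrize_mem_lowDegree hact (prod_mem_lowDegree hTA le_rfl)) hf)
  rw [mul_right_comm, ← symmetrize_mul_of_invariant hinv, hsum, map_add, map_sum, map_sum,
    sum_congr rfl hswap, sum_const, add_mul, smul_mul_assoc, sum_mul, map_add, map_nsmul, map_sum,
    sum_congr rfl (fun i hi => hc i hi f hf), ← sum_mul, nsmul_eq_mul] at hzero
  rw [div_mul_eq_mul_div, eq_div_iff hAT.ne']
  linarith

/-- A balanced functional on `2 * m + 1` signs is nonnegative on squares of polynomials of degree
at most `m`. -/
theorem IsBalanced.map_sq_nonneg [Fintype σ] [DecidableEq σ] (hx : ∀ i, x i ^ 2 = 1)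
    (hact : ∀ π i, act π (x i) = x (π i)) {L : R →ₗ[ℝ] ℝ} (hL : IsBalanced x act A L)
    (hA : #A = 2 * m + 1) {f : R} (hf : f ∈ lowDegree x A m) : 0 ≤ L (f ^ 2) := by
  induction m generalizing A L f with
  | zero =>
    obtain ⟨c, rfl⟩ := lowDegree_zero_exists hf
    rw [smul_pow, one_pow, map_smul]
    exact mul_nonneg (sq_nonneg c) hL.map_one_nonneg
  | succ m ih =>
    obtain ⟨g, hg, hinv, hle⟩ := hL.exists_invariant_of_sub_swap_nonneg hact
      (fun i hi j hj hij f hf => by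
        obtain ⟨q, hq, h⟩ := exists_sub_swap_eq hact hij hf
        rw [h, mul_pow]
        exact ih (hL.mul_sq_sub hx hact (by omega) hi hj hij) (by grind) hq) hf Subset.rfl
    refine le_trans ?_ hle
    obtain ⟨N, hN, hsymm⟩ := symmetrize_apply_of_invariant (act := act) (A := A)
    have hscalar : ∀ p ∈ lowDegree x A (m + 1), ∃ c : ℝ, ∀ f ∈ lowDegree x A (m + 1),
        L (symmetrize act A p * f) = c * L f := by
      refine fun p hp => lowDegree_induction (p := fun p => ∃ c : ℝ,
        ∀ f ∈ lowDegree x A (m + 1), L (symmetrize act A p * f) = c * L f)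
        (fun S hS hd => hL.exists_map_symmetrize_prod_mul hx hact hA.ge hS hd)
        ⟨0, by simp⟩ ?_ ?_ hp
      · rintro p q ⟨a, ha⟩ ⟨b, hb⟩
        refine ⟨a + b, fun f hf => ?_⟩
        rw [map_add, add_mul, map_add, ha f hf, hb f hf, add_mul]
      · rintro c p ⟨a, ha⟩
        refine ⟨c * a, fun f hf => ?_⟩
        rw [map_smul, smul_mul_assoc, map_smul, ha f hf, smul_eq_mul, mul_assoc]
    obtain ⟨c, hc⟩ := hscalar g hg
    simp only [hsymm g hinv, smul_mul_assoc, map_smul, smul_eq_mul] at hc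
    have h1 := hc 1 one_mem_lowDegree
    have h2 := hc g hg
    rw [mul_one] at h1
    have h3 : L (g ^ 2) = (c / N) ^ 2 * L 1 := by
      rw [sq]
      field_simp
      linear_combination N * h2 + c * h1
    rw [h3]
    exact mul_nonneg (sq_nonneg _) hL.map_one_nonneg

end Balanced

section GrigorievLaurent

variable {σ : Type*}

/-- The sign `x i` in the group algebra of `σ → ZMod 2`, i.e. in the algebra of multilinear
polynomials modulo `x i ^ 2 = 1`. -/
noncomputable def sign [DecidableEq σ] (i : σ) : AddMonoidAlgebra ℝ (σ → ZMod 2) :=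
  AddMonoidAlgebra.single (Pi.single i 1) 1

/-- The action of permutations of the indices on multilinear polynomials in the signs. -/
noncomputable def permAct :
    Perm σ →* (AddMonoidAlgebra ℝ (σ → ZMod 2) →ₐ[ℝ] AddMonoidAlgebra ℝ (σ → ZMod 2)) where
  toFun π := AddMonoidAlgebra.mapDomainAlgHom ℝ ℝ (LinearMap.funLeft (ZMod 2) (ZMod 2) π.symm)
  map_one' := by
    ext
    simp [LinearMap.funLeft, Perm.one_def]
  map_mul' π ρ := by
    ext
    simp [LinearMap.funLeft, Function.comp_assoc, Perm.mul_def]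

theorem permAct_single (π : Perm σ) (g : σ → ZMod 2) (r : ℝ) :
    permAct π (AddMonoidAlgebra.single g r) = AddMonoidAlgebra.single (g ∘ π.symm) r := by
  simp [permAct, LinearMap.funLeft]

theorem sign_sq [DecidableEq σ] (i : σ) : sign i ^ 2 = 1 := by
  rw [sign, sq, AddMonoidAlgebra.single_mul_single, ← Pi.single_add, CharTwo.add_self_eq_zero]
  simp [AddMonoidAlgebra.one_def]

theorem permAct_sign [DecidableEq σ] (π : Perm σ) (i : σ) :
    permAct π (sign i) = sign (π i) := by
  rw [sign, permAct_single, sign]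
  congr 1
  ext j
  simp [Pi.single_apply, Equiv.symm_apply_eq]

theorem prod_sign [DecidableEq σ] (S : Finset σ) :
    ∏ i ∈ S, sign i = AddMonoidAlgebra.single (fun i => if i ∈ S then 1 else 0) 1 := by
  induction S using Finset.induction_on with
  | empty => simp [AddMonoidAlgebra.one_def]; rfl
  | insert a S ha ih =>
    rw [prod_insert ha, ih, sign, AddMonoidAlgebra.single_mul_single, one_mul]
    congr 1
    ext j
    by_cases h : j = a
    · subst h; simp [ha]
    · simp [h]

/-- The value on a product of `k` distinct signs of the exchangeable functional on `n` signs for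
which the sum of the signs vanishes. -/
noncomputable def balancedMoment (n : ℕ) : ℕ → ℝ
  | 0 => 1
  | 1 => 0
  | k + 2 => -((k + 1) / (n - (k + 1))) * balancedMoment n k

theorem balancedMoment_recursion {n k : ℕ} (hk : k + 2 ≤ n) :
    (n - k) * balancedMoment n (k + 1) + k * balancedMoment n (k - 1) = 0 := by
  cases k with
  | zero => simp [balancedMoment]
  | succ k =>
    have h : (n : ℝ) - (k + 1) ≠ 0 := by
      have h1 : ((k + 1 + 2 : ℕ) : ℝ) ≤ n := by exact_mod_cast hk
      push_cast at h1
      linarith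
    rw [balancedMoment, Nat.add_sub_cancel]
    push_cast
    field_simp
    ring

/-- The Grigoriev–Laurent pseudo-expectation. -/
noncomputable def pseudoExpectation (σ : Type*) [Fintype σ] :
    AddMonoidAlgebra ℝ (σ → ZMod 2) →ₗ[ℝ] ℝ :=
  Finsupp.linearCombination ℝ
      (fun g : σ → ZMod 2 => balancedMoment (Fintype.card σ) #{i | g i ≠ 0}) ∘ₗ
    (AddMonoidAlgebra.coeffLinearEquiv ℝ).toLinearMap

theorem pseudoExpectation_single [Fintype σ] (g : σ → ZMod 2) (r : ℝ) :
    pseudoExpectation σ (AddMonoidAlgebra.single g r)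
      = r * balancedMoment (Fintype.card σ) #{i | g i ≠ 0} := by
  simp [pseudoExpectation]

variable [Fintype σ] [DecidableEq σ]

theorem pseudoExpectation_prod_sign (S : Finset σ) :
    pseudoExpectation σ (∏ i ∈ S, sign i) = balancedMoment (Fintype.card σ) #S := by
  rw [prod_sign, pseudoExpectation_single]
  simp

theorem pseudoExpectation_one : pseudoExpectation σ 1 = 1 := by
  simpa [balancedMoment] using pseudoExpectation_prod_sign (σ := σ) ∅

theorem isBalanced_pseudoExpectation :
    IsBalanced sign permAct univ (pseudoExpectation σ) where
  map_act π _ f := by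
    have h : pseudoExpectation σ ∘ₗ (permAct π).toLinearMap = pseudoExpectation σ := by
      ext g
      simp only [LinearMap.comp_apply, AlgHom.toLinearMap_apply, AddMonoidAlgebra.lsingle_apply,
        permAct_single, pseudoExpectation_single]
      congr 2
      exact card_equiv π.symm (by simp)
    exact LinearMap.congr_fun h f
  map_mul_sum d hd f hf := by
    refine lowDegree_induction (p := fun f => pseudoExpectation σ (f * ∑ i, sign i) = 0)
      (fun S _ hS => ?_) (by simp) (fun f g hf hg => by rw [add_mul, map_add, hf, hg, add_zero])
      (fun c f hf => by rw [smul_mul_assoc, map_smul, hf, smul_zero]) hf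
    rw [card_univ] at hd
    have h1 : ∀ i ∈ Sᶜ, pseudoExpectation σ ((∏ j ∈ S, sign j) * sign i)
        = balancedMoment (Fintype.card σ) (#S + 1) := fun i hi => by
      rw [mul_comm, ← prod_insert (mem_compl.1 hi), pseudoExpectation_prod_sign,
        card_insert_of_notMem (mem_compl.1 hi)]
    have h2 : ∀ i ∈ S, pseudoExpectation σ ((∏ j ∈ S, sign j) * sign i)
        = balancedMoment (Fintype.card σ) (#S - 1) := fun i hi => by
      rw [mul_comm, mul_prod_of_mem sign_sq hi, pseudoExpectation_prod_sign,
        card_erase_of_mem hi]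
    rw [mul_sum, map_sum, ← sum_compl_add_sum S, sum_congr rfl h1, sum_congr rfl h2, sum_const,
      sum_const, card_compl, nsmul_eq_mul, nsmul_eq_mul, Nat.cast_sub (by omega)]
    exact balancedMoment_recursion (by omega)
  map_one_nonneg := by
    rw [pseudoExpectation_one]
    exact zero_le_one

theorem aeval_mem_lowDegree {R : Type*} [CommRing R] [Algebra ℝ R] {x : σ → R}
    (hx : ∀ i, x i ^ 2 = 1) {p : MvPolynomial σ ℝ} {d : ℕ} (hp : p.totalDegree ≤ d) :
    MvPolynomial.aeval x p ∈ lowDegree x univ d := by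
  rw [p.as_sum, map_sum]
  refine Submodule.sum_mem _ fun α hα => ?_
  rw [MvPolynomial.aeval_monomial, ← Algebra.smul_def]
  refine Submodule.smul_mem _ _ (lowDegree_mono Subset.rfl
    ((MvPolynomial.le_totalDegree hα).trans hp) ?_)
  rw [Finsupp.prod, Finsupp.sum]
  have hpow : ∀ i k, x i ^ k ∈ lowDegree x univ k := by
    intro i k
    induction k with
    | zero => simpa using one_mem_lowDegree
    | succ k ih =>
      rw [pow_succ']
      exact generator_mul_mem_lowDegree hx (mem_univ i) ih
  induction α.support using Finset.induction_on with
  | empty => simpa using one_mem_lowDegree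
  | insert a S ha ih =>
    rw [prod_insert ha, sum_insert ha]
    exact mul_mem_lowDegree hx (hpow _ _) ih

end GrigorievLaurent

/-- Grigoriev–Laurent lower bound: for odd `n`, the system `{x_i² = 1, ∑ x_i = 0}` admits no
sum-of-squares refutation of degree at most `n − 1`. -/
theorem no_low_degree_sos_refutation_of_odd_sum (n : ℕ) (hn : Odd n) :
    ¬ ∃ (t : ℕ) (g : Fin n → MvPolynomial (Fin n) ℝ) (g₀ : MvPolynomial (Fin n) ℝ)
        (h : Fin t → MvPolynomial (Fin n) ℝ),
      (∀ i, (g i * (MvPolynomial.X i ^ 2 - 1)).totalDegree ≤ n - 1) ∧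
      (g₀ * ∑ i, MvPolynomial.X i).totalDegree ≤ n - 1 ∧
      (∀ j, ((h j) ^ 2).totalDegree ≤ n - 1) ∧
      (∑ i, g i * (MvPolynomial.X i ^ 2 - 1)) + g₀ * (∑ i, MvPolynomial.X i)
        = (∑ j, (h j) ^ 2) + 1 := by
  rintro ⟨t, g, g₀, h, -, hg₀, hh, heq⟩
  obtain ⟨m, rfl⟩ := hn
  set φ := MvPolynomial.aeval (R := ℝ) (sign (σ := Fin (2 * m + 1)))
  have hsum : pseudoExpectation (Fin (2 * m + 1)) (φ (g₀ * ∑ i, MvPolynomial.X i)) = 0 := by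
    by_cases h0 : g₀ = 0
    · simp [h0]
    have hX : (∑ i : Fin (2 * m + 1), MvPolynomial.X i : MvPolynomial _ ℝ).totalDegree ≠ 0 := by
      intro h1
      have h2 := MvPolynomial.totalDegree_eq_zero_iff_eq_C.1 h1
      have h3 := congrArg (MvPolynomial.coeff (Finsupp.single 0 1)) h2
      simp [MvPolynomial.coeff_sum, MvPolynomial.coeff_X, Finsupp.single_left_inj] at h3
    rw [MvPolynomial.totalDegree_mul_of_isDomain h0 (by rintro h1; simp [h1] at hX)] at hg₀
    rw [map_mul, map_sum]
    simp only [φ, MvPolynomial.aeval_X]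
    exact isBalanced_pseudoExpectation.map_mul_sum g₀.totalDegree
      (by rw [card_univ, Fintype.card_fin]; omega) _ (aeval_mem_lowDegree sign_sq le_rfl)
  have hsq : ∀ j, 0 ≤ pseudoExpectation (Fin (2 * m + 1)) (φ (h j) ^ 2) := by
    intro j
    refine isBalanced_pseudoExpectation.map_sq_nonneg (m := m) sign_sq permAct_sign (by simp)
      (aeval_mem_lowDegree sign_sq ?_)
    by_cases h0 : h j = 0
    · simp [h0]
    have h1 := hh j
    rw [sq, MvPolynomial.totalDegree_mul_of_isDomain h0 h0] at h1
    omega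
  have hfinal := congrArg (fun p => pseudoExpectation (Fin (2 * m + 1)) (φ p)) heq
  have hcube : φ (∑ i, g i * (MvPolynomial.X i ^ 2 - 1)) = 0 := by
    simp [φ, sign_sq]
  simp only [map_add, hcube, map_zero, hsum, map_sum, map_pow, map_one,
    pseudoExpectation_one] at hfinal
  linarith [sum_nonneg fun j (_ : j ∈ univ) => hsq j]
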